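/- Let k ⊆ L = k(x) be a finite separable field extension, f ∈ k[X] the minimal polynomial of x over k, and f = (X − x)·f₁⋯f_r the factorization of the image of f in L[X] into monic irreducible factors. If K is an intermediate field of k ⊆ L such that K ⊂ L is minimal (no intermediate field strictly between K and L), then K is a principal subfield: there exists α ∈ {1,…,r} with K = L_α = {h(x) : h ∈ k[X], f_α divides h(X) − h(x) in L[X]}. -/

import Mathlib

open Polynomial

/-- `A ⊂ B` is a minimal extension of intermediate fields of `k ⊆ L`. -/
def MinimalExtF {k L : Type*} [Field k] [Field L] [Algebra k L]
    (A B : IntermediateField k L) : Prop :=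
  A < B ∧ ∀ T : IntermediateField k L, A < T → ¬ T < B

/-- The principal subfield attached to a polynomial `p` over `L = k(x)`: the elements `h(x)`,
`h ∈ k[X]`, such that `p` divides `h(X) - h(x)`. -/
def principalSubfield {k L : Type*} [Field k] [Field L] [Algebra k L]
    [Algebra.IsAlgebraic k L] (x : L) (p : L[X]) : IntermediateField k L :=
  Subalgebra.IsAlgebraic.toIntermediateField (S :=
    { carrier := {y : L | ∃ h : k[X], aeval x h = y ∧ p ∣ h.map (algebraMap k L) - C y}
      mul_mem' := by
        rintro a b ⟨g, hg, hga⟩ ⟨h, hh, hhb⟩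
        refine ⟨g * h, by rw [map_mul, hg, hh], ?_⟩
        have key : (g * h).map (algebraMap k L) - C (a * b) =
            (g.map (algebraMap k L) - C a) * h.map (algebraMap k L) +
              C a * (h.map (algebraMap k L) - C b) := by
          rw [Polynomial.map_mul, C_mul]
          ring
        rw [key]
        exact dvd_add (hga.mul_right _) (hhb.mul_left _)
      add_mem' := by
        rintro a b ⟨g, hg, hga⟩ ⟨h, hh, hhb⟩
        refine ⟨g + h, by rw [map_add, hg, hh], ?_⟩
        rw [Polynomial.map_add, C_add, add_sub_add_comm]
        exact dvd_add hga hhb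
      algebraMap_mem' := fun c => ⟨C c, aeval_C x c, by simp⟩ })
    (fun y _ => Algebra.IsAlgebraic.isAlgebraic y)

theorem mem_principalSubfield {k L : Type*} [Field k] [Field L] [Algebra k L]
    [Algebra.IsAlgebraic k L] {x : L} {p : L[X]} {y : L} :
    y ∈ principalSubfield (k := k) x p ↔
      ∃ h : k[X], aeval x h = y ∧ p ∣ h.map (algebraMap k L) - C y :=
  Iff.rfl

/-- An intermediate field `K` is contained in the principal subfield of any divisor of the
minimal polynomial of `x` over `K`. -/
theorem le_principalSubfield {k L : Type*} [Field k] [Field L] [Algebra k L]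
    [Algebra.IsAlgebraic k L] {x : L} (hx : IntermediateField.adjoin k {x} = ⊤) {p : L[X]}
    (K : IntermediateField k L) (hp : p ∣ (minpoly K x).map (algebraMap K L)) :
    K ≤ principalSubfield x p := by
  intro y hy
  have hyx : y ∈ IntermediateField.adjoin k {x} := hx ▸ IntermediateField.mem_top
  rw [← IntermediateField.mem_toSubalgebra,
    IntermediateField.adjoin_simple_toSubalgebra_of_isAlgebraic (Algebra.IsAlgebraic.isAlgebraic x),
    Algebra.adjoin_singleton_eq_range_aeval] at hyx
  obtain ⟨h, rfl⟩ := hyx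
  refine mem_principalSubfield.mpr ⟨h, rfl, hp.trans ?_⟩
  have hmin : minpoly K x ∣ h.map (algebraMap k K) - C ⟨aeval x h, hy⟩ :=
    minpoly.dvd K x (by simp)
  have hmap := Polynomial.map_dvd (algebraMap K L) hmin
  rwa [Polynomial.map_sub, Polynomial.map_map, ← IsScalarTower.algebraMap_eq, map_C] at hmap

/-- A factor of the minimal polynomial of `x` not dividing `X - x` has a proper principal
subfield. -/
theorem principalSubfield_ne_top {k L : Type*} [Field k] [Field L] [Algebra k L]
    [Algebra.IsAlgebraic k L] {x : L} {p : L[X]}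
    (hp : p ∣ (minpoly k x).map (algebraMap k L)) (hpx : ¬ p ∣ X - C x) :
    principalSubfield (k := k) x p ≠ ⊤ := by
  intro htop
  obtain ⟨h, hh, hd⟩ :=
    mem_principalSubfield.mp (htop ▸ IntermediateField.mem_top : x ∈ principalSubfield (k := k) x p)
  have hf : minpoly k x ∣ h - X := minpoly.dvd k x (by simp [hh])
  have hd' := hp.trans (Polynomial.map_dvd (algebraMap k L) hf)
  rw [Polynomial.map_sub, map_X] at hd'
  exact hpx (by simpa using dvd_sub hd hd')

theorem stmt_11 {k L : Type*} [Field k] [Field L] [Algebra k L]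
    [FiniteDimensional k L] [Algebra.IsSeparable k L]
    (x : L) (hx : IntermediateField.adjoin k {x} = ⊤)
    (r : ℕ) (f : Fin r → L[X])
    (hfm : ∀ i, (f i).Monic) (hfi : ∀ i, Irreducible (f i))
    (hfact : (minpoly k x).map (algebraMap k L) = (X - C x) * ∏ i, f i)
    (K : IntermediateField k L) (hK : MinimalExtF K ⊤) :
    ∃ α : Fin r, (K : Set L) =
      {y : L | ∃ h : Polynomial k, Polynomial.aeval x h = y ∧
        f α ∣ (h.map (algebraMap k L) - C y)} := by
  have hxK : x ∉ K := fun hmem => hK.1.ne (top_le_iff.mp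
    (hx ▸ IntermediateField.adjoin_simple_le_iff.mpr hmem))
  obtain ⟨q, hq⟩ : X - C x ∣ (minpoly K x).map (algebraMap K L) :=
    dvd_iff_isRoot.mpr (by simp [IsRoot, eval_map_algebraMap])
  have hq_unit : ¬ IsUnit q := by
    intro hu
    have hdeg : (minpoly K x).natDegree = 1 := by
      rw [← natDegree_map (algebraMap K L), hq,
        natDegree_mul (X_sub_C_ne_zero x) hu.ne_zero, natDegree_X_sub_C,
        natDegree_eq_zero_of_isUnit hu]
    obtain ⟨y, hy⟩ := minpoly.natDegree_eq_one_iff.mp hdeg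
    exact hxK (hy ▸ y.2)
  have hq_dvd : q ∣ ∏ i, f i := by
    have hdvd := Polynomial.map_dvd (algebraMap K L) (minpoly.dvd_map_of_isScalarTower k K x)
    rw [Polynomial.map_map, ← IsScalarTower.algebraMap_eq, hfact, hq] at hdvd
    exact (mul_dvd_mul_iff_left (X_sub_C_ne_zero x)).mp hdvd
  have hq_ne : q ≠ 0 := by
    rintro rfl
    exact Finset.prod_ne_zero_iff.mpr (fun i _ => (hfi i).ne_zero) (zero_dvd_iff.mp hq_dvd)
  obtain ⟨p, hp, hpq⟩ := WfDvdMonoid.exists_irreducible_factor hq_unit hq_ne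
  obtain ⟨α, -, hpα⟩ := hp.prime.exists_mem_finset_dvd (hpq.trans hq_dvd)
  have hαq : f α ∣ q := (hp.associated_of_dvd (hfi α) hpα).dvd_iff_dvd_left.mp hpq
  have hα_prod : f α ∣ ∏ i, f i := Finset.dvd_prod_of_mem f (Finset.mem_univ α)
  have hαx : ¬ f α ∣ X - C x := by
    intro hd
    have hsq : Squarefree ((minpoly k x).map (algebraMap k L)) :=
      (Separable.map (Algebra.IsSeparable.isSeparable k x)).squarefree
    exact (hfi α).not_isUnit (hsq _ (hfact ▸ mul_dvd_mul hd hα_prod))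
  have hle : K ≤ principalSubfield x (f α) :=
    le_principalSubfield hx K (hq ▸ hαq.mul_left _)
  have hne : principalSubfield (k := k) x (f α) ≠ ⊤ :=
    principalSubfield_ne_top (hfact ▸ hα_prod.mul_left _) hαx
  have heq : K = principalSubfield x (f α) := by
    by_contra hKne
    exact hK.2 _ (lt_of_le_of_ne hle hKne) hne.lt_top
  exact ⟨α, congrArg SetLike.coe heq⟩
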